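/- arXiv:2101.11886 — 2 statements merged into one kernel-verified Lean document; each statement's English description precedes it below -/
import Mathlib

section
/- For any n, p ∈ ℕ, if A ⊆ 2^{[n]} is such that |x △ y| ≤ p for every pair x, y ∈ A, then |C^p(A)| ≤ |C^p(I_{|A|})|. -/
open Finset

/-- Strict simplicial order on subsets of `[n]` (as `Finset (Fin n)`):
`x` precedes `y` iff `|x| < |y|`, or `|x| = |y|` and `min (x ∆ y) ∈ x`. -/
def SimpLT {n : ℕ} (x y : Finset (Fin n)) : Prop :=
  x.card < y.card ∨
    (x.card = y.card ∧ ∃ i, i ∈ x ∧ i ∉ y ∧ ∀ j ∈ symmDiff x y, i ≤ j)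

instance {n : ℕ} (x y : Finset (Fin n)) : Decidable (SimpLT x y) := by
  unfold SimpLT; infer_instance

/-- `ISeg n m` : the initial segment consisting of the first `m` subsets of `[n]`
in the simplicial ordering (the sets having fewer than `m` strict predecessors). -/
def ISeg (n m : ℕ) : Finset (Finset (Fin n)) :=
  Finset.univ.filter fun x => (Finset.univ.filter fun z => SimpLT z x).card < m

/-- `Cball n p A` : the set `C^p[A]` of all subsets of `[n]` at symmetric-difference
distance at most `p` from every member of `A`. -/
def Cball (n p : ℕ) (A : Finset (Finset (Fin n))) : Finset (Finset (Fin n)) :=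
  Finset.univ.filter fun y => ∀ x ∈ A, (symmDiff x y).card ≤ p

/-- `Cpunct n p A` : the set `C^p(A) = C^p[A] \ A`. -/
def Cpunct (n p : ℕ) (A : Finset (Finset (Fin n))) : Finset (Finset (Fin n)) :=
  Cball n p A \ A

/-- The `p`-th power of the hypercube `Q_n`: vertices are subsets of `[n]`,
adjacent iff the symmetric difference has size between `1` and `p`. -/
def cubePow (n p : ℕ) : SimpleGraph (Finset (Fin n)) where
  Adj x y := 1 ≤ (symmDiff x y).card ∧ (symmDiff x y).card ≤ p
  symm := ⟨fun x y h => by simpa [symmDiff_comm] using h⟩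
  loopless := ⟨fun x h => by simp [symmDiff_self] at h⟩

/-- `G` admits a b-coloring with `k` colors: a proper coloring with colors `Fin k`
such that every color class contains a vertex having a neighbor in each other
color class. -/
def HasBColoring {V : Type*} (G : SimpleGraph V) (k : ℕ) : Prop :=
  ∃ c : V → Fin k,
    (∀ x y, G.Adj x y → c x ≠ c y) ∧
    (∀ i : Fin k, ∃ v, c v = i ∧ ∀ j : Fin k, j ≠ i → ∃ w, G.Adj v w ∧ c w = j)

/-- The `p`-th power of the Hamming graph `H_{n,q}`: vertices are `q`-ary `n`-tuples,
adjacent iff their Hamming distance is between `1` and `p`. -/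
def hammingPow (n q p : ℕ) : SimpleGraph (Fin n → ZMod q) where
  Adj x y := 1 ≤ hammingDist x y ∧ hammingDist x y ≤ p
  symm := ⟨fun x y h => by simpa [hammingDist_comm] using h⟩
  loopless := ⟨fun x h => by simp at h⟩

theorem symmDiff_insert_insert {n : ℕ} {x y : Finset (Fin n)} {i : Fin n} (hx : i ∉ x)
    (hy : i ∉ y) : symmDiff (insert i x) (insert i y) = symmDiff x y := by
  ext j
  simp only [mem_symmDiff, mem_insert]
  grind

namespace SimpLT

variable {n : ℕ} {x y z : Finset (Fin n)}

theorem irrefl (x : Finset (Fin n)) : ¬ SimpLT x x := by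
  rintro (h | ⟨_, i, hi, hi', _⟩)
  · exact lt_irrefl _ h
  · exact hi' hi

theorem trans (hxy : SimpLT x y) (hyz : SimpLT y z) : SimpLT x z := by
  rcases hxy with h | ⟨h, i, hix, hiy, hi⟩
  · rcases hyz with h' | ⟨h', _⟩ <;> exact Or.inl (by omega)
  · rcases hyz with h' | ⟨h', j, hjy, hjz, hj⟩
    · exact Or.inl (by omega)
    · refine Or.inr ⟨h.trans h', ?_⟩
      simp only [mem_symmDiff] at *
      rcases lt_or_ge i j with hij | hij
      · exact ⟨i, by grind⟩
      · exact ⟨j, by grind⟩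

theorem trichotomous (x y : Finset (Fin n)) : SimpLT x y ∨ x = y ∨ SimpLT y x := by
  rcases lt_trichotomy x.card y.card with h | h | h
  · exact Or.inl (Or.inl h)
  · by_cases hxy : x = y
    · exact Or.inr (Or.inl hxy)
    · have hne : (symmDiff x y).Nonempty := by
        rwa [nonempty_iff_ne_empty, ← bot_eq_empty, Ne, symmDiff_eq_bot]
      have hmin := min'_le (symmDiff x y)
      rcases mem_symmDiff.1 (min'_mem _ hne) with ⟨h₁, h₂⟩ | ⟨h₁, h₂⟩
      · exact Or.inl (Or.inr ⟨h, _, h₁, h₂, hmin⟩)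
      · exact Or.inr (Or.inr (Or.inr ⟨h.symm, _, h₁, h₂, by rwa [symmDiff_comm y x]⟩))
  · exact Or.inr (Or.inr (Or.inl h))

theorem insert_insert {i : Fin n} (hx : i ∉ x) (hy : i ∉ y) :
    SimpLT (insert i x) (insert i y) ↔ SimpLT x y := by
  have hm : ∀ j, (j ∈ insert i x ∧ j ∉ insert i y) ↔ (j ∈ x ∧ j ∉ y) := by grind
  unfold SimpLT
  rw [symmDiff_insert_insert hx hy, card_insert_of_notMem hx, card_insert_of_notMem hy]
  simp only [← and_assoc, hm, add_lt_add_iff_right, add_left_inj]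

theorem of_ssubset (h : x ⊂ y) : SimpLT x y := Or.inl (card_lt_card h)

end SimpLT

/-- The number of strict predecessors of `x` in the simplicial order. -/
def simpRank {n : ℕ} (x : Finset (Fin n)) : ℕ :=
  (univ.filter fun z => SimpLT z x).card

theorem simpRank_lt {n : ℕ} {x y : Finset (Fin n)} (h : SimpLT x y) :
    simpRank x < simpRank y := by
  refine card_lt_card ⟨fun z hz => ?_, fun hss => ?_⟩
  · simp only [mem_filter, mem_univ, true_and] at *
    exact hz.trans h
  · have := hss (by simpa using h : x ∈ univ.filter fun z => SimpLT z y)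
    exact SimpLT.irrefl x (by simpa using this)

theorem simpRank_injective (n : ℕ) :
    Function.Injective (simpRank : Finset (Fin n) → ℕ) := by
  intro x y h
  rcases SimpLT.trichotomous x y with h' | h' | h'
  · exact absurd (simpRank_lt h') (by omega)
  · exact h'
  · exact absurd (simpRank_lt h') (by omega)

theorem card_ISeg {n m : ℕ} (hm : m ≤ 2 ^ n) : (ISeg n m).card = m := by
  have himg : (univ : Finset (Finset (Fin n))).image simpRank = range (2 ^ n) := by
    refine eq_of_subset_of_card_le (fun r hr => ?_) ?_
    · obtain ⟨x, _, rfl⟩ := mem_image.1 hr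
      have h : (univ.filter fun z => SimpLT z x) ⊂ univ :=
        ⟨subset_univ _, fun h => SimpLT.irrefl x (by simpa using h (mem_univ x))⟩
      simpa [simpRank] using card_lt_card h
    · rw [card_image_of_injective _ (simpRank_injective n)]
      simp
  rw [← card_image_of_injective _ (simpRank_injective n)]
  have : (ISeg n m).image simpRank = range m := by
    ext r
    have hr := Finset.ext_iff.1 himg r
    simp only [mem_image, mem_univ, true_and, mem_range] at hr
    simp only [ISeg, mem_image, mem_filter, mem_univ, true_and, mem_range]
    constructor
    · rintro ⟨x, hx, rfl⟩
      exact hx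
    · intro h
      obtain ⟨x, rfl⟩ := hr.2 (by omega)
      exact ⟨x, h, rfl⟩
  rw [this, card_range]

/-- `B` is an initial segment of the simplicial order restricted to the subsets of `S`. -/
def IsSimpInit {n : ℕ} (S : Finset (Fin n)) (B : Finset (Finset (Fin n))) : Prop :=
  B ⊆ S.powerset ∧ ∀ y ∈ B, ∀ x ⊆ S, SimpLT x y → x ∈ B

theorem isSimpInit_ISeg (n m : ℕ) : IsSimpInit univ (ISeg n m) := by
  refine ⟨fun x _ => by simp, fun y hy x _ hxy => ?_⟩
  simp only [ISeg, mem_filter, mem_univ, true_and] at *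
  exact (simpRank_lt hxy).trans hy

namespace IsSimpInit

variable {n : ℕ} {S : Finset (Fin n)} {A B : Finset (Finset (Fin n))}

theorem exists_card_eq (S : Finset (Fin n)) {m : ℕ} (hm : m ≤ S.powerset.card) :
    ∃ B, IsSimpInit S B ∧ B.card = m := by
  induction m with
  | zero => exact ⟨∅, ⟨by simp, by simp⟩, rfl⟩
  | succ m ih =>
    obtain ⟨B, hB, hcard⟩ := ih (by omega)
    have hne : (S.powerset \ B).Nonempty := by
      rw [← card_pos, card_sdiff_of_subset hB.1]
      omega
    obtain ⟨x, hx, hmin⟩ := exists_min_image _ simpRank hne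
    rw [mem_sdiff] at hx
    refine ⟨insert x B, ⟨insert_subset hx.1 hB.1, fun y hy z hz hzy => ?_⟩, ?_⟩
    · rcases mem_insert.1 hy with rfl | hy
      · by_contra hzB
        have := hmin z (mem_sdiff.2 ⟨mem_powerset.2 hz, fun h => hzB (mem_insert_of_mem h)⟩)
        exact absurd (simpRank_lt hzy) (by omega)
      · exact mem_insert_of_mem (hB.2 y hy z hz hzy)
    · rw [card_insert_of_notMem hx.2, hcard]

theorem subset_or_subset (hA : IsSimpInit S A) (hB : IsSimpInit S B) : A ⊆ B ∨ B ⊆ A := by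
  by_contra! h
  obtain ⟨x, hxA, hxB⟩ := not_subset.1 h.1
  obtain ⟨y, hyB, hyA⟩ := not_subset.1 h.2
  rcases SimpLT.trichotomous x y with h' | rfl | h'
  · exact hxB (hB.2 y hyB x (mem_powerset.1 (hA.1 hxA)) h')
  · exact hxB hyB
  · exact hyA (hA.2 x hxA y (mem_powerset.1 (hB.1 hyB)) h')

theorem subset_of_card_le (hA : IsSimpInit S A) (hB : IsSimpInit S B)
    (h : A.card ≤ B.card) : A ⊆ B := by
  rcases hA.subset_or_subset hB with h' | h'
  · exact h'
  · exact (eq_of_subset_of_card_le h' h).ge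

theorem card_union (hA : IsSimpInit S A) (hB : IsSimpInit S B) :
    (A ∪ B).card = max A.card B.card := by
  rcases hA.subset_or_subset hB with h | h
  · rw [union_eq_right.2 h, max_eq_right (card_le_card h)]
  · rw [union_eq_left.2 h, max_eq_left (card_le_card h)]

/-- An initial segment minimises the sum of any function that is strictly increasing for the
simplicial order, and it is the only minimiser of its size. -/
theorem sum_lt_sum (hB : IsSimpInit S B) (hA : A ⊆ S.powerset) (hcard : B.card = A.card)
    (hne : B ≠ A) (f : Finset (Fin n) → ℕ)
    (hf : ∀ x ∈ S.powerset, ∀ y ∈ S.powerset, SimpLT x y → f x < f y) :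
    ∑ x ∈ B, f x < ∑ x ∈ A, f x := by
  have hc : (B \ A).card = (A \ B).card := card_sdiff_comm hcard
  have hpos : 0 < (B \ A).card := by
    rw [card_pos, sdiff_nonempty]
    exact fun h => hne (eq_of_subset_of_card_le h hcard.ge)
  obtain ⟨c, hc', hmax⟩ := exists_max_image (B \ A) f (card_pos.1 hpos)
  rw [mem_sdiff] at hc'
  have h₁ : ∑ x ∈ B \ A, f x ≤ (B \ A).card • f c := sum_le_card_nsmul _ _ _ hmax
  have h₂ : (A \ B).card • (f c + 1) ≤ ∑ x ∈ A \ B, f x := by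
    refine card_nsmul_le_sum _ _ _ fun x hx => ?_
    rw [mem_sdiff] at hx
    refine hf c (hB.1 hc'.1) x (hA hx.1) ?_
    rcases SimpLT.trichotomous c x with h | rfl | h
    · exact h
    · exact absurd hx.1 hc'.2
    · exact absurd (hB.2 c hc'.1 x (mem_powerset.1 (hA hx.1)) h) hx.2
  have h₃ := sum_inter_add_sum_sdiff B A f
  have h₄ := sum_inter_add_sum_sdiff A B f
  rw [inter_comm] at h₄
  rw [hc] at h₁
  simp only [smul_eq_mul, mul_add, mul_one] at h₁ h₂
  omega

theorem sum_le_sum (hB : IsSimpInit S B) (hA : A ⊆ S.powerset) (hcard : B.card = A.card)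
    (f : Finset (Fin n) → ℕ)
    (hf : ∀ x ∈ S.powerset, ∀ y ∈ S.powerset, SimpLT x y → f x < f y) :
    ∑ x ∈ B, f x ≤ ∑ x ∈ A, f x := by
  by_cases h : B = A
  · rw [h]
  · exact (hB.sum_lt_sum hA hcard h f hf).le

end IsSimpInit

/-- The sets in `S.powerset` at symmetric-difference distance at most `t` from the family `A`. -/
def cubeNhd {n : ℕ} (S : Finset (Fin n)) (t : ℕ) (A : Finset (Finset (Fin n))) :
    Finset (Finset (Fin n)) :=
  S.powerset.filter fun y => ∃ x ∈ A, (symmDiff x y).card ≤ t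

section cubeNhd

variable {n : ℕ} {S : Finset (Fin n)} {A B : Finset (Finset (Fin n))} {x y : Finset (Fin n)}

theorem mem_cubeNhd {t : ℕ} :
    y ∈ cubeNhd S t A ↔ y ⊆ S ∧ ∃ x ∈ A, (symmDiff x y).card ≤ t := by
  simp [cubeNhd]

theorem cubeNhd_mono {t : ℕ} (h : A ⊆ B) : cubeNhd S t A ⊆ cubeNhd S t B := by
  intro y hy
  rw [mem_cubeNhd] at *
  obtain ⟨hy, x, hx, hxy⟩ := hy
  exact ⟨hy, x, h hx, hxy⟩

theorem symmDiff_insert_self {i : Fin n} (hx : i ∉ x) : symmDiff x (insert i x) = {i} := by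
  ext j
  simp only [mem_symmDiff, mem_insert, mem_singleton]
  grind

theorem card_symmDiff_insert_le_one_iff {i : Fin n} (hx : i ∉ x) (hy : i ∉ y) :
    (symmDiff x (insert i y)).card ≤ 1 ↔ x = y := by
  constructor
  · intro h
    rw [card_le_one] at h
    ext j
    by_contra hj
    have hji := h j (by simp only [mem_symmDiff, mem_insert]; grind) i
      (by simp only [mem_symmDiff, mem_insert]; grind)
    grind
  · rintro rfl
    rw [symmDiff_insert_self hx, card_singleton]

theorem card_symmDiff_le_one (h : (symmDiff x y).card ≤ 1) :
    y = x ∨ (∃ j ∉ x, y = insert j x) ∨ ∃ j ∈ x, y = x.erase j := by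
  rcases Nat.le_one_iff_eq_zero_or_eq_one.1 h with h | h
  · rw [card_eq_zero, ← bot_eq_empty, symmDiff_eq_bot] at h
    exact Or.inl h.symm
  · obtain ⟨j, hj⟩ := card_eq_one.1 h
    have hmem : ∀ a, a ∈ symmDiff x y ↔ a = j := by simp [hj]
    simp only [mem_symmDiff] at hmem
    by_cases hjx : j ∈ x
    · exact Or.inr (Or.inr ⟨j, hjx, by ext a; have := hmem a; have := hmem j; grind⟩)
    · exact Or.inr (Or.inl ⟨j, hjx, by ext a; have := hmem a; have := hmem j; grind⟩)

theorem symmDiff_erase_self {k : Fin n} (hk : k ∈ x) : symmDiff (x.erase k) x = {k} := by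
  ext j
  simp only [mem_symmDiff, mem_erase, mem_singleton]
  grind

theorem nonMemberSubfamily_cubeNhd (hA : A ⊆ S.powerset) (i : Fin n) :
    (cubeNhd S 1 A).nonMemberSubfamily i =
      cubeNhd (S.erase i) 1 (A.nonMemberSubfamily i) ∪
        A.memberSubfamily i := by
  ext y
  simp only [mem_nonMemberSubfamily, mem_memberSubfamily, mem_union, mem_cubeNhd,
    subset_erase]
  constructor
  · rintro ⟨⟨hyS, x, hxA, hxy⟩, hiy⟩
    by_cases hix : i ∈ x
    · right
      have h : y = x.erase i := by
        rw [symmDiff_comm, ← insert_erase hix,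
          card_symmDiff_insert_le_one_iff hiy (notMem_erase i x)] at hxy
        exact hxy
      subst h
      exact ⟨by rwa [insert_erase hix], hiy⟩
    · exact Or.inl ⟨⟨hyS, hiy⟩, x, ⟨hxA, hix⟩, hxy⟩
  · rintro (⟨⟨hyS, hiy⟩, x, ⟨hxA, _⟩, hxy⟩ | ⟨hyA, hiy⟩)
    · exact ⟨⟨hyS, x, hxA, hxy⟩, hiy⟩
    · refine ⟨⟨(subset_insert i y).trans (mem_powerset.1 (hA hyA)), _, hyA, ?_⟩, hiy⟩
      rw [symmDiff_comm, symmDiff_insert_self hiy, card_singleton]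

theorem memberSubfamily_cubeNhd (hA : A ⊆ S.powerset) {i : Fin n} (hi : i ∈ S) :
    (cubeNhd S 1 A).memberSubfamily i =
      cubeNhd (S.erase i) 1 (A.memberSubfamily i) ∪
        A.nonMemberSubfamily i := by
  ext y
  simp only [mem_nonMemberSubfamily, mem_memberSubfamily, mem_union, mem_cubeNhd,
    subset_erase, insert_subset_iff]
  constructor
  · rintro ⟨⟨⟨_, hyS⟩, x, hxA, hxy⟩, hiy⟩
    by_cases hix : i ∈ x
    · rw [← insert_erase hix, symmDiff_insert_insert (notMem_erase i x) hiy] at hxy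
      exact Or.inl ⟨⟨hyS, hiy⟩, x.erase i, ⟨by rwa [insert_erase hix], notMem_erase i x⟩, hxy⟩
    · rw [card_symmDiff_insert_le_one_iff hix hiy] at hxy
      subst hxy
      exact Or.inr ⟨hxA, hix⟩
  · rintro (⟨⟨hyS, hiy⟩, x, ⟨hxA, hix⟩, hxy⟩ | ⟨hyA, hiy⟩)
    · exact ⟨⟨⟨hi, hyS⟩, _, hxA, by rwa [symmDiff_insert_insert hix hiy]⟩, hiy⟩
    · refine ⟨⟨⟨hi, mem_powerset.1 (hA hyA)⟩, _, hyA, ?_⟩, hiy⟩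
      rw [symmDiff_insert_self hiy, card_singleton]

theorem cubeNhd_univ_add_one (t : ℕ) (A : Finset (Finset (Fin n))) :
    cubeNhd univ (t + 1) A = cubeNhd univ 1 (cubeNhd univ t A) := by
  ext y
  simp only [mem_cubeNhd, subset_univ, true_and]
  constructor
  · rintro ⟨x, hx, hxy⟩
    rcases (symmDiff x y).eq_empty_or_nonempty with h | ⟨j, hj⟩
    · exact ⟨y, ⟨x, hx, by simp [h]⟩, by simp⟩
    · refine ⟨symmDiff y {j}, ⟨x, hx, ?_⟩, ?_⟩
      · have : symmDiff x (symmDiff y {j}) = (symmDiff x y).erase j := by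
          ext a
          simp only [mem_symmDiff, mem_erase, mem_singleton] at *
          grind
        rw [this, card_erase_of_mem hj]
        omega
      · rw [symmDiff_comm, symmDiff_symmDiff_cancel_left, card_singleton]
  · rintro ⟨z, ⟨x, hx, hxz⟩, hzy⟩
    refine ⟨x, hx, ?_⟩
    have h₁ : symmDiff x y ⊆ symmDiff x z ∪ symmDiff z y := symmDiff_triangle x z y
    have h₂ := (card_le_card h₁).trans (card_union_le _ _)
    omega

theorem cubeNhd_univ_zero (A : Finset (Finset (Fin n))) : cubeNhd univ 0 A = A := by
  ext y
  rw [mem_cubeNhd]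
  constructor
  · rintro ⟨_, x, hx, hxy⟩
    rw [nonpos_iff_eq_zero, card_eq_zero, ← bot_eq_empty, symmDiff_eq_bot] at hxy
    exact hxy ▸ hx
  · exact fun h => ⟨subset_univ _, y, h, by simp⟩

end cubeNhd

namespace SimpLT

variable {n : ℕ} {x y : Finset (Fin n)}

/-- If `x` precedes `y` and both have the same size, then removing the maximum from `x` gives
a set that does not come after any set obtained by removing one element from `y`. -/
theorem not_erase_erase (hxy : SimpLT x y) (hcard : x.card = y.card) {j k : Fin n}
    (hj : j ∈ y) (hk : k ∈ x) (hmax : ∀ a ∈ x, a ≤ k) :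
    ¬ SimpLT (y.erase j) (x.erase k) := by
  have hc : (x.erase k).card = (y.erase j).card := by
    rw [card_erase_of_mem hk, card_erase_of_mem hj, hcard]
  rcases hxy with h | ⟨_, i, hix, hiy, hi⟩
  · omega
  rintro (h | ⟨_, i', hi'y, hi'x, hi'⟩)
  · omega
  simp only [mem_symmDiff, mem_erase] at *
  by_cases hik : i = k
  · subst hik
    by_cases hjx : j ∈ x.erase i
    · have := hi' j
      have := hi i'
      have := hmax j
      grind
    · have hsub : x.erase i ⊆ y.erase j := by
        intro a ha
        have := hi a
        have := hmax a
        grind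
      have := eq_of_subset_of_card_le hsub hc.ge
      rw [Finset.ext_iff] at this
      have := this i'
      grind
  · have := hi' i
    have := hi i'
    have := hmax i
    grind

theorem erase_self {k : Fin n} (hk : k ∈ x) : SimpLT (x.erase k) x :=
  of_ssubset (erase_ssubset hk)

end SimpLT

theorem IsSimpInit.cubeNhd {n : ℕ} {S : Finset (Fin n)} {B : Finset (Finset (Fin n))}
    (hB : IsSimpInit S B) : IsSimpInit S (cubeNhd S 1 B) := by
  refine ⟨filter_subset _ _, fun y hy x hxS hxy => ?_⟩
  obtain ⟨hyS, b, hb, hby⟩ := mem_cubeNhd.1 hy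
  refine mem_cubeNhd.2 ⟨hxS, ?_⟩
  suffices h : x ∈ B ∨ ∃ k ∈ x, x.erase k ∈ B by
    rcases h with h | ⟨k, hk, h⟩
    · exact ⟨x, h, by simp⟩
    · exact ⟨_, h, by rw [symmDiff_erase_self hk, card_singleton]⟩
  rw [symmDiff_comm] at hby
  have hbS : b ⊆ S := mem_powerset.1 (hB.1 hb)
  have hlt : ∀ z ⊆ S, SimpLT z b → z ∈ B := fun z hz h => hB.2 b hb z hz h
  rcases card_symmDiff_le_one hby with rfl | ⟨j, hj, rfl⟩ | ⟨j, hj, rfl⟩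
  · exact Or.inl (hlt x hxS hxy)
  · exact Or.inl (hlt x hxS (hxy.trans (SimpLT.of_ssubset (ssubset_insert hj))))
  · rcases x.eq_empty_or_nonempty with rfl | hne
    · left
      rcases (y.erase j).eq_empty_or_nonempty with h | h
      · rwa [h] at hb
      · exact hlt _ hxS (Or.inl (by simpa using h.card_pos))
    · right
      refine ⟨x.max' hne, max'_mem _ _, ?_⟩
      have hzS : x.erase (x.max' hne) ⊆ S := (erase_subset _ _).trans hxS
      have hle : x.card ≤ y.card := by
        rcases hxy with h | h
        · exact h.le
        · exact h.1.le
      rcases hle.eq_or_lt with hc | hc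
      · have hn := hxy.not_erase_erase hc hj (max'_mem x hne) (le_max' x)
        rcases SimpLT.trichotomous (x.erase (x.max' hne)) (y.erase j) with h | h | h
        · exact hlt _ hzS h
        · rwa [h]
        · exact absurd h hn
      · refine hlt _ hzS (Or.inl ?_)
        have := hne.card_pos
        rw [card_erase_of_mem hj, card_erase_of_mem (max'_mem x hne)]
        omega

section slices

variable {n : ℕ} {S : Finset (Fin n)} {A C D : Finset (Finset (Fin n))} {i : Fin n}

theorem nonMemberSubfamily_subset_powerset_erase (hA : A ⊆ S.powerset) :
    A.nonMemberSubfamily i ⊆ (S.erase i).powerset := by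
  intro x hx
  rw [mem_nonMemberSubfamily] at hx
  exact mem_powerset.2 (subset_erase.2 ⟨mem_powerset.1 (hA hx.1), hx.2⟩)

theorem memberSubfamily_subset_powerset_erase (hA : A ⊆ S.powerset) :
    A.memberSubfamily i ⊆ (S.erase i).powerset := by
  intro x hx
  rw [mem_memberSubfamily] at hx
  exact mem_powerset.2
    (subset_erase.2 ⟨(subset_insert i x).trans (mem_powerset.1 (hA hx.1)), hx.2⟩)

theorem sum_nonMemberSubfamily_add_sum_memberSubfamily (i : Fin n)
    (A : Finset (Finset (Fin n))) (f : Finset (Fin n) → ℕ) :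
    ∑ x ∈ A.nonMemberSubfamily i, f x + ∑ x ∈ A.memberSubfamily i, f (insert i x) =
      ∑ x ∈ A, f x := by
  have h : ∑ x ∈ A.memberSubfamily i, f (insert i x) = ∑ x ∈ A with i ∈ x, f x := by
    rw [← image_insert_memberSubfamily, sum_image]
    intro x hx y hy hxy
    exact insert_erase_invOn.2.injOn (mem_memberSubfamily.1 hx).2 (mem_memberSubfamily.1 hy).2 hxy
  rw [h, nonMemberSubfamily, add_comm, sum_filter_add_sum_filter_not]

theorem nonMemberSubfamily_union_image_insert (hC : ∀ x ∈ C, i ∉ x) :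
    (C ∪ D.image (insert i)).nonMemberSubfamily i = C := by
  rw [nonMemberSubfamily_union, nonMemberSubfamily_image_insert, union_empty]
  exact filter_true_of_mem hC

theorem memberSubfamily_union_image_insert (hC : ∀ x ∈ C, i ∉ x) (hD : ∀ x ∈ D, i ∉ x) :
    (C ∪ D.image (insert i)).memberSubfamily i = D := by
  rw [memberSubfamily_union, memberSubfamily_image_insert hD]
  suffices h : C.memberSubfamily i = ∅ by rw [h, empty_union]
  rw [eq_empty_iff_forall_notMem]
  intro x hx
  exact hC _ (mem_memberSubfamily.1 hx).1 (mem_insert_self i x)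

/-- Replacing both slices of `A` in direction `i` by initial segments does not increase the
neighbourhood, provided that initial segments minimise neighbourhoods in `S.erase i`. It strictly
decreases the total rank unless both slices were initial segments already. -/
theorem exists_compression (hi : i ∈ S) (hA : A ⊆ S.powerset)
    (ih : ∀ A ⊆ (S.erase i).powerset, ∀ B, IsSimpInit (S.erase i) B → B.card = A.card →
      (cubeNhd (S.erase i) 1 B).card ≤ (cubeNhd (S.erase i) 1 A).card)
    (hbad : ¬ (IsSimpInit (S.erase i) (A.nonMemberSubfamily i) ∧
      IsSimpInit (S.erase i) (A.memberSubfamily i))) :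
    ∃ A' ⊆ S.powerset, A'.card = A.card ∧ (cubeNhd S 1 A').card ≤ (cubeNhd S 1 A).card ∧
      ∑ x ∈ A', simpRank x < ∑ x ∈ A, simpRank x := by
  have hA₀ := nonMemberSubfamily_subset_powerset_erase (i := i) hA
  have hA₁ := memberSubfamily_subset_powerset_erase (i := i) hA
  obtain ⟨C, hC, hCcard⟩ := IsSimpInit.exists_card_eq (S.erase i) (card_le_card hA₀)
  obtain ⟨D, hD, hDcard⟩ := IsSimpInit.exists_card_eq (S.erase i) (card_le_card hA₁)
  have hnot : ∀ x ∈ (S.erase i).powerset, i ∉ x := fun x hx h =>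
    notMem_erase i S (mem_powerset.1 hx h)
  have hCi : ∀ x ∈ C, i ∉ x := fun x hx => hnot x (hC.1 hx)
  have hDi : ∀ x ∈ D, i ∉ x := fun x hx => hnot x (hD.1 hx)
  set A' := C ∪ D.image (insert i) with hA'
  have h₀ : A'.nonMemberSubfamily i = C := nonMemberSubfamily_union_image_insert hCi
  have h₁ : A'.memberSubfamily i = D := memberSubfamily_union_image_insert hCi hDi
  have hA'S : A' ⊆ S.powerset := by
    refine union_subset (hC.1.trans (powerset_mono.2 (erase_subset i S))) fun x hx => ?_
    obtain ⟨z, hz, rfl⟩ := mem_image.1 hx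
    exact mem_powerset.2
      (insert_subset hi ((mem_powerset.1 (hD.1 hz)).trans (erase_subset i S)))
  refine ⟨A', hA'S, ?_, ?_, ?_⟩
  · rw [← card_memberSubfamily_add_card_nonMemberSubfamily i A',
      ← card_memberSubfamily_add_card_nonMemberSubfamily i A, h₀, h₁, hCcard, hDcard]
  · rw [← card_memberSubfamily_add_card_nonMemberSubfamily i (cubeNhd S 1 A'),
      ← card_memberSubfamily_add_card_nonMemberSubfamily i (cubeNhd S 1 A),
      memberSubfamily_cubeNhd hA hi, memberSubfamily_cubeNhd hA'S hi,
      nonMemberSubfamily_cubeNhd hA, nonMemberSubfamily_cubeNhd hA'S, h₀, h₁,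
      hD.cubeNhd.card_union hC, hC.cubeNhd.card_union hD, hCcard, hDcard]
    have hC' := ih _ hA₀ C hC hCcard
    have hD' := ih _ hA₁ D hD hDcard
    exact add_le_add
      (max_le (hD'.trans (card_le_card subset_union_left)) (card_le_card subset_union_right))
      (max_le (hC'.trans (card_le_card subset_union_left)) (card_le_card subset_union_right))
  · rw [← sum_nonMemberSubfamily_add_sum_memberSubfamily i A',
      ← sum_nonMemberSubfamily_add_sum_memberSubfamily i A, h₀, h₁]
    have hf₀ : ∀ x ∈ (S.erase i).powerset, ∀ y ∈ (S.erase i).powerset, SimpLT x y →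
        simpRank x < simpRank y := fun x _ y _ h => simpRank_lt h
    have hf₁ : ∀ x ∈ (S.erase i).powerset, ∀ y ∈ (S.erase i).powerset, SimpLT x y →
        simpRank (insert i x) < simpRank (insert i y) := fun x hx y hy h =>
      simpRank_lt ((SimpLT.insert_insert (hnot x hx) (hnot y hy)).2 h)
    by_cases hne : C = A.nonMemberSubfamily i
    · have hne' : D ≠ A.memberSubfamily i := by
        rintro rfl
        exact hbad ⟨hne ▸ hC, hD⟩
      exact add_lt_add_of_le_of_lt (hC.sum_le_sum hA₀ hCcard _ hf₀)
        (hD.sum_lt_sum hA₁ hDcard hne' _ hf₁)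
    · exact add_lt_add_of_lt_of_le (hC.sum_lt_sum hA₀ hCcard hne _ hf₀)
        (hD.sum_le_sum hA₁ hDcard _ hf₁)

end slices

/-- If the only failures of `A` to be an initial segment are pairs of complementary sets, then
some initial segment of the same size has a neighbourhood that is no larger. -/
theorem exists_isSimpInit_of_forall_eq_sdiff {n : ℕ} {S : Finset (Fin n)}
    {A : Finset (Finset (Fin n))} (hA : A ⊆ S.powerset)
    (hcompl : ∀ y ∈ A, ∀ x ⊆ S, SimpLT x y → x ∉ A → y = S \ x) :
    ∃ I, IsSimpInit S I ∧ I.card = A.card ∧ (cubeNhd S 1 I).card ≤ (cubeNhd S 1 A).card := by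
  by_cases hinit : IsSimpInit S A
  · exact ⟨A, hinit, rfl, le_rfl⟩
  obtain ⟨y, hyA, x, hxS, hxy, hxA⟩ : ∃ y ∈ A, ∃ x ⊆ S, SimpLT x y ∧ x ∉ A := by
    by_contra! h
    exact hinit ⟨hA, h⟩
  have hy : y = S \ x := hcompl y hyA x hxS hxy hxA
  have hyS : y ⊆ S := mem_powerset.1 (hA hyA)
  have hx : ∀ v ⊆ S, y = S \ v → v = x := by
    intro v hv h
    rw [← Finset.sdiff_sdiff_eq_self hv, ← h, hy, Finset.sdiff_sdiff_eq_self hxS]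
  have hbelow : ∀ v ⊆ S, SimpLT v y → v ≠ x → v ∈ A := fun v hv hvy hvx => by
    by_contra h
    exact hvx (hx v hv (hcompl y hyA v hv hvy h))
  have habove : ∀ u ∈ A, ¬ SimpLT y u := fun u hu hyu => by
    have := hcompl u hu x hxS (hxy.trans hyu) hxA
    rw [this, ← hy] at hyu
    exact SimpLT.irrefl y hyu
  refine ⟨insert x (A.erase y), ⟨?_, ?_⟩, ?_, card_le_card fun w hw => ?_⟩
  · exact insert_subset (mem_powerset.2 hxS) ((erase_subset y A).trans hA)
  · intro u hu v hv hvu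
    have huy : SimpLT u y := by
      rcases mem_insert.1 hu with rfl | hu
      · exact hxy
      · rcases SimpLT.trichotomous u y with h | h | h
        · exact h
        · exact absurd h (ne_of_mem_erase hu)
        · exact absurd h (habove u (mem_of_mem_erase hu))
    by_cases hvx : v = x
    · rw [hvx]
      exact mem_insert_self x _
    · have hvy := hvu.trans huy
      refine mem_insert_of_mem (mem_erase.2 ⟨?_, hbelow v hv hvy hvx⟩)
      rintro rfl
      exact SimpLT.irrefl v hvy
  · rw [card_insert_of_notMem fun h => hxA (mem_of_mem_erase h), card_erase_of_mem hyA]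
    have := card_pos.2 ⟨y, hyA⟩
    omega
  · obtain ⟨hwS, u, hu, huw⟩ := mem_cubeNhd.1 hw
    refine mem_cubeNhd.2 ⟨hwS, ?_⟩
    rcases mem_insert.1 hu with rfl | hu
    swap
    · exact ⟨u, mem_of_mem_erase hu, huw⟩
    suffices h : w ∈ A ∨ (∃ k ∈ w, w.erase k ∈ A) ∨ ∃ k ∉ w, insert k w ∈ A by
      rcases h with h | ⟨k, hk, h⟩ | ⟨k, hk, h⟩
      · exact ⟨w, h, by simp⟩
      · exact ⟨_, h, by rw [symmDiff_erase_self hk, card_singleton]⟩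
      · exact ⟨_, h, by rw [symmDiff_comm, symmDiff_insert_self hk, card_singleton]⟩
    rcases card_symmDiff_le_one huw with rfl | ⟨j, hj, rfl⟩ | ⟨j, hj, rfl⟩
    · rcases w.eq_empty_or_nonempty with rfl | ⟨k, hk⟩
      · right; right
        rw [sdiff_empty] at hy
        subst hy
        have hne : y.Nonempty := by
          rw [nonempty_iff_ne_empty]
          rintro rfl
          exact hxA hyA
        obtain ⟨k, hk⟩ := hne
        refine ⟨k, notMem_empty k, ?_⟩
        rcases (singleton_subset_iff.2 hk).eq_or_ssubset with h | h
        · rwa [insert_empty, h]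
        · rw [insert_empty]
          exact hbelow _ (singleton_subset_iff.2 hk) (SimpLT.of_ssubset h)
            (singleton_ne_empty k)
      · right; left
        exact ⟨k, hk, hbelow _ ((erase_subset k w).trans hwS)
          ((SimpLT.erase_self hk).trans hxy) (erase_ne_self.2 hk)⟩
    · have hjS : j ∈ S := hwS (mem_insert_self j u)
      have hjy : j ∈ y := hy ▸ mem_sdiff.2 ⟨hjS, hj⟩
      rcases u.eq_empty_or_nonempty with rfl | hne
      · left
        rw [insert_empty] at hwS ⊢
        rcases (singleton_subset_iff.2 hjy).eq_or_ssubset with h | h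
        · rwa [h]
        · exact hbelow _ hwS (SimpLT.of_ssubset h) (singleton_ne_empty j)
      · right; left
        obtain ⟨k, hk, hmax⟩ : ∃ k ∈ u, ∀ a ∈ u, a ≤ k := ⟨_, max'_mem u hne, le_max' u⟩
        have hkj : k ≠ j := by rintro rfl; exact hj hk
        refine ⟨k, mem_insert_of_mem hk, ?_⟩
        have hvS : (insert j u).erase k ⊆ S := (erase_subset _ _).trans hwS
        have hcard : ((insert j u).erase k).card = u.card := by
          rw [card_erase_of_mem (mem_insert_of_mem hk), card_insert_of_notMem hj]
          omega
        have hvne : (insert j u).erase k ≠ u := fun h => by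
          rw [Finset.ext_iff] at h
          have := h k
          grind
        rcases SimpLT.trichotomous ((insert j u).erase k) y with h | h | h
        · exact hbelow _ hvS h hvne
        · rwa [h]
        · exfalso
          have hle : u.card ≤ y.card := by
            rcases hxy with h | h
            · exact h.le
            · exact h.1.le
          rcases h with h | ⟨hyv, i', hi'y, hi'v, hi'⟩
          · omega
          rcases hxy with h | ⟨_, i, hiu, hiy, hi⟩
          · omega
          have hmemy : ∀ a, a ∈ y ↔ a ∈ S ∧ a ∉ u := by simp [hy]
          have hiS := hxS hiu
          simp only [mem_symmDiff, mem_erase, mem_insert] at hi hi' hi'v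
          by_cases hik : i = k
          · subst hik
            have hsub : u ⊆ {i} := fun a ha => by
              have := hi a
              have := hmax a ha
              grind
            have hij : i' ≠ j := by grind
            have h₁ := card_le_card hsub
            have h₂ := card_le_card (insert_subset hi'y (singleton_subset_iff.2 hjy))
            rw [card_pair hij] at h₂
            rw [card_singleton] at h₁
            omega
          · have := hi i'
            have := hi' i
            grind
    · left
      exact hbelow _ hwS ((SimpLT.erase_self hj).trans hxy) (erase_ne_self.2 hj)

/-- Harper's vertex-isoperimetric inequality for the subsets of `S`. -/
theorem card_cubeNhd_le_of_isSimpInit {n : ℕ} (S : Finset (Fin n)) :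
    ∀ A ⊆ S.powerset, ∀ B, IsSimpInit S B → B.card = A.card →
      (cubeNhd S 1 B).card ≤ (cubeNhd S 1 A).card := by
  induction S using Finset.strongInduction with
  | H S ihS =>
    intro A hA B hB hcard
    induction hs : ∑ x ∈ A, simpRank x using Nat.strong_induction_on generalizing A with
    | _ s ih =>
      subst hs
      by_cases hslice : ∀ i ∈ S, IsSimpInit (S.erase i) (A.nonMemberSubfamily i) ∧
          IsSimpInit (S.erase i) (A.memberSubfamily i)
      · have hcompl : ∀ y ∈ A, ∀ x ⊆ S, SimpLT x y → x ∉ A → y = S \ x := by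
          intro y hy x hx hxy hxA
          have hyS := mem_powerset.1 (hA hy)
          ext i
          rw [mem_sdiff]
          by_cases hiS : i ∈ S
          swap
          · exact iff_of_false (fun h => hiS (hyS h)) fun h => hiS h.1
          obtain ⟨h₀, h₁⟩ := hslice i hiS
          by_cases hix : i ∈ x <;> by_cases hiy : i ∈ y
          · exfalso
            have := h₁.2 (y.erase i) (by simp [insert_erase hiy, hy]) (x.erase i)
              (erase_subset_erase i hx) (by
                rwa [← SimpLT.insert_insert (notMem_erase i x) (notMem_erase i y),
                  insert_erase hix, insert_erase hiy])
            rw [mem_memberSubfamily, insert_erase hix] at this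
            exact hxA this.1
          · simp [hix, hiy]
          · simp [hix, hiy, hiS]
          · exfalso
            have := h₀.2 y (by simp [hiy, hy]) x (subset_erase.2 ⟨hx, hix⟩) hxy
            exact hxA (mem_nonMemberSubfamily.1 this).1
        obtain ⟨I, hI, hIcard, hle⟩ := exists_isSimpInit_of_forall_eq_sdiff hA hcompl
        have hBI := hB.subset_of_card_le hI (by omega)
        exact (card_le_card (cubeNhd_mono hBI)).trans hle
      · push Not at hslice
        obtain ⟨i, hi, hbad⟩ := hslice
        obtain ⟨A', hA', hA'card, hle, hlt⟩ :=
          exists_compression hi hA (ihS _ (erase_ssubset hi)) fun h => hbad h.1 h.2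
        exact (ih _ hlt A' hA' (by omega) rfl).trans hle

theorem card_cubeNhd_ISeg_le {n : ℕ} (A : Finset (Finset (Fin n))) (t : ℕ) :
    (cubeNhd univ t (ISeg n A.card)).card ≤ (cubeNhd univ t A).card := by
  have hcard : (ISeg n A.card).card = A.card := card_ISeg (by simpa using card_le_univ A)
  suffices h : IsSimpInit univ (cubeNhd univ t (ISeg n A.card)) ∧
      (cubeNhd univ t (ISeg n A.card)).card ≤ (cubeNhd univ t A).card from h.2
  induction t with
  | zero =>
    rw [cubeNhd_univ_zero, cubeNhd_univ_zero]
    exact ⟨isSimpInit_ISeg n _, hcard.le⟩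
  | succ t ih =>
    rw [cubeNhd_univ_add_one t A, cubeNhd_univ_add_one t (ISeg n A.card)]
    refine ⟨ih.1.cubeNhd, ?_⟩
    have hsub : cubeNhd univ t A ⊆ (univ : Finset (Fin n)).powerset := filter_subset _ _
    obtain ⟨I, hI, hIcard⟩ := IsSimpInit.exists_card_eq univ (card_le_card hsub)
    exact (card_le_card (cubeNhd_mono (ih.1.subset_of_card_le hI (by omega)))).trans
      (card_cubeNhd_le_of_isSimpInit univ _ hsub I hI hIcard)

theorem card_symmDiff_compl {n : ℕ} (x y : Finset (Fin n)) :
    (symmDiff x yᶜ).card + (symmDiff x y).card = n := by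
  have h : symmDiff x yᶜ = (symmDiff x y)ᶜ := by
    ext a
    simp only [mem_symmDiff, mem_compl]
    tauto
  rw [h, card_compl, Fintype.card_fin]
  have := card_le_univ (symmDiff x y)
  rw [Fintype.card_fin] at this
  omega

theorem card_Cball_add_card_cubeNhd {n p : ℕ} (hp : p < n) (A : Finset (Finset (Fin n))) :
    (Cball n p A).card + (cubeNhd univ (n - p - 1) A).card = 2 ^ n := by
  have h : (cubeNhd univ (n - p - 1) A).card = (Cball n p A)ᶜ.card := by
    rw [← card_image_of_injective _ compl_injective]
    congr 1
    ext y
    rw [mem_image]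
    have key : ∀ z, z ∈ cubeNhd univ (n - p - 1) A ↔ zᶜ ∈ (Cball n p A)ᶜ := by
      intro z
      simp only [mem_cubeNhd, subset_univ, true_and, Cball, mem_compl, mem_filter, mem_univ,
        not_forall, exists_prop]
      refine exists_congr fun x => and_congr_right fun _ => ?_
      have := card_symmDiff_compl x z
      omega
    exact ⟨fun ⟨z, hz, hzy⟩ => hzy ▸ (key z).1 hz,
      fun hy => ⟨yᶜ, (key _).2 (by rwa [compl_compl]), compl_compl y⟩⟩
  rw [h, card_add_card_compl]
  simp

theorem card_Cball_le (n p : ℕ) (A : Finset (Finset (Fin n))) :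
    (Cball n p A).card ≤ (Cball n p (ISeg n A.card)).card := by
  rcases lt_or_ge p n with hp | hp
  · have h₁ := card_Cball_add_card_cubeNhd hp A
    have h₂ := card_Cball_add_card_cubeNhd hp (ISeg n A.card)
    have h₃ := card_cubeNhd_ISeg_le A (n - p - 1)
    omega
  · refine card_le_card fun y _ => ?_
    simp only [Cball, mem_filter, mem_univ, true_and]
    intro x _
    have := card_symmDiff_compl x y
    omega

/-- If every pair of members of `A` is at symmetric-difference distance at most `p`,
then `|C^p(A)| ≤ |C^p(I_{|A|})|`. -/
theorem stmt2 (n p : ℕ) (A : Finset (Finset (Fin n)))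
    (h : ∀ x ∈ A, ∀ y ∈ A, (symmDiff x y).card ≤ p) :
    (Cpunct n p A).card ≤ (Cpunct n p (ISeg n A.card)).card := by
  have hsub : A ⊆ Cball n p A := fun y hy => by
    simpa [Cball] using fun x hx => h x hx y hy
  have hcard : (ISeg n A.card).card = A.card := card_ISeg (by simpa using card_le_univ A)
  rw [Cpunct, Cpunct, card_sdiff_of_subset hsub]
  have h₁ := card_Cball_le n p A
  have h₂ := le_card_sdiff (ISeg n A.card) (Cball n p (ISeg n A.card))
  omega
end

section
/- Let n be even and n/2 + 1 ≤ p ≤ n−2. Set r' = Σ_{i=0}^{p−n/2} C(n,i) + C(n−1, p−n/2) and s' = C(p−1, p−n/2). Then |C^p(I_{r'−s'})| = 2^{n−1} − (r' − 2s'). -/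
open Finset

theorem SimpLT.irrefl_s4 {n : ℕ} (x : Finset (Fin n)) : ¬ SimpLT x x := by
  rintro (h | ⟨-, i, hi, hi', -⟩)
  · exact lt_irrefl _ h
  · exact hi' hi

theorem SimpLT.total {n : ℕ} {x y : Finset (Fin n)} (h : x ≠ y) : SimpLT x y ∨ SimpLT y x := by
  rcases lt_trichotomy x.card y.card with hc | hc | hc
  · exact Or.inl (Or.inl hc)
  · have hne : (symmDiff x y).Nonempty := by
      rw [Finset.nonempty_iff_ne_empty]
      exact fun h0 => h (symmDiff_eq_bot.mp h0)
    have hmem := Finset.min'_mem _ hne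
    have hmin : ∀ j ∈ symmDiff x y, (symmDiff x y).min' hne ≤ j :=
      fun j hj => Finset.min'_le _ j hj
    rcases Finset.mem_symmDiff.mp hmem with ⟨h1, h2⟩ | ⟨h1, h2⟩
    · exact Or.inl (Or.inr ⟨hc, _, h1, h2, hmin⟩)
    · exact Or.inr (Or.inr ⟨hc.symm, _, h1, h2, by rwa [symmDiff_comm y x]⟩)
  · exact Or.inr (Or.inl hc)

/-- A family closed under simplicial predecessors is an initial segment. -/
theorem ISeg_card_eq {n : ℕ} {A : Finset (Finset (Fin n))}
    (hA : ∀ x ∈ A, ∀ z, SimpLT z x → z ∈ A) : ISeg n A.card = A := by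
  ext x
  simp only [ISeg, mem_filter, mem_univ, true_and]
  constructor
  · intro h
    by_contra hx
    refine absurd h (not_lt.mpr (card_le_card fun z hz => ?_))
    have hzx : z ≠ x := fun e => hx (e ▸ hz)
    rcases SimpLT.total hzx with h1 | h1
    · simpa using h1
    · exact absurd (hA z hz x h1) hx
  · intro hx
    refine card_lt_card ((ssubset_iff_of_subset fun z hz => hA x hx z (by simpa using hz)).mpr
      ⟨x, hx, ?_⟩)
    simpa using SimpLT.irrefl_s4 x

theorem card_symmDiff_add_two_mul_card_inter {α : Type*} [DecidableEq α] (x y : Finset α) :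
    (symmDiff x y).card + 2 * (x ∩ y).card = x.card + y.card := by
  have h : (symmDiff x y).card = (x \ y).card + (y \ x).card :=
    card_union_of_disjoint disjoint_sdiff_sdiff
  have h1 := card_sdiff_add_card_inter x y
  have h2 := card_sdiff_add_card_inter y x
  rw [inter_comm y x] at h2
  omega

theorem card_filter_card_lt {α : Type*} [Fintype α] (k : ℕ) :
    (univ.filter fun x : Finset α => x.card < k).card =
      ∑ i ∈ range k, (Fintype.card α).choose i := by
  rw [card_eq_sum_card_fiberwise (f := Finset.card) (t := range k) (by intro x hx; simpa using hx)]
  refine sum_congr rfl fun i hi => ?_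
  rw [← Finset.card_univ, ← card_powersetCard]
  congr 1
  ext x
  simp only [mem_filter, mem_univ, true_and, mem_powersetCard, subset_univ]
  rw [mem_range] at hi
  omega

section Counting

variable {α : Type*} [Fintype α] [DecidableEq α]

theorem card_filter_card_eq_subset_subset {B D : Finset α} (hBD : B ⊆ D) {k : ℕ}
    (hk : B.card ≤ k) :
    (univ.filter fun x : Finset α => x.card = k ∧ B ⊆ x ∧ x ⊆ D).card =
      (D.card - B.card).choose (k - B.card) := by
  rw [← card_sdiff_of_subset hBD, ← card_powersetCard]
  refine card_bij' (fun x _ => x \ B) (fun x _ => x ∪ B) ?_ ?_ ?_ ?_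
  · intro x hx
    simp only [mem_filter, mem_univ, true_and] at hx
    rw [mem_powersetCard]
    exact ⟨sdiff_subset_sdiff hx.2.2 le_rfl, by rw [card_sdiff_of_subset hx.2.1, hx.1]⟩
  · intro x hx
    rw [mem_powersetCard] at hx
    have hd : Disjoint x B := disjoint_of_subset_left hx.1 sdiff_disjoint
    simp only [mem_filter, mem_univ, true_and]
    refine ⟨?_, subset_union_right, union_subset (hx.1.trans sdiff_subset) hBD⟩
    rw [card_union_of_disjoint hd, hx.2]
    omega
  · intro x hx
    simp only [mem_filter, mem_univ, true_and] at hx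
    exact sdiff_union_of_subset hx.2.1
  · intro x hx
    rw [mem_powersetCard] at hx
    have hd : Disjoint x B := disjoint_of_subset_left hx.1 sdiff_disjoint
    exact union_sdiff_cancel_right hd

/-- All sets of size at most `t`, together with those of size `t + 1` containing `a` and
meeting `K`. -/
def punctFamily (a : α) (K : Finset α) (t : ℕ) : Finset (Finset α) :=
  univ.filter fun x => x.card < t + 1 ∨ (x.card = t + 1 ∧ a ∈ x ∧ ¬ Disjoint x K)

theorem card_punctFamily_add {a : α} {K : Finset α} (ha : a ∉ K) (t : ℕ) :
    (punctFamily a K t).card + (Fintype.card α - K.card - 1).choose t =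
      ∑ i ∈ range (t + 1), (Fintype.card α).choose i + (Fintype.card α - 1).choose t := by
  have h1 := card_filter_card_eq_subset_subset (B := {a}) (D := Kᶜ) (by simpa using ha)
    (k := t + 1) (by simp)
  have h2 := card_filter_card_eq_subset_subset (B := {a}) (D := univ) (by simp)
    (k := t + 1) (by simp)
  rw [card_compl, card_singleton, Nat.add_sub_cancel] at h1
  rw [Finset.card_univ, card_singleton, Nat.add_sub_cancel] at h2
  rw [← h1, ← h2, ← card_filter_card_lt, ← card_union_of_disjoint, ← card_union_of_disjoint]
  · congr 1
    ext x
    simp only [punctFamily, mem_union, mem_filter, mem_univ, true_and, singleton_subset_iff,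
      subset_univ, and_true, subset_compl_iff_disjoint_right]
    tauto
  · rw [disjoint_filter]
    rintro x - h ⟨h', -⟩
    omega
  · rw [punctFamily, disjoint_filter]
    simp only [subset_compl_iff_disjoint_right]
    rintro x - (h | h) ⟨h', -, h''⟩
    · omega
    · exact h.2.2 h''

theorem forall_punctFamily_card_symmDiff_le_iff {a : α} {K : Finset α} (ha : a ∉ K) {m t : ℕ}
    (hα : Fintype.card α = 2 * m) (ht : 1 ≤ t) (htm : t + 1 ≤ m) (y : Finset α) :
    (∀ x ∈ punctFamily a K t, (symmDiff x y).card ≤ m + t) ↔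
      y.card < m ∨ (y.card = m ∧ a ∈ y) ∨ (y.card = m ∧ a ∉ y ∧ K ⊆ y) := by
  have hyc : y.card + yᶜ.card = 2 * m := by rw [card_add_card_compl, hα]
  have hdisj : ∀ x ⊆ yᶜ, (symmDiff x y).card = x.card + y.card := by
    intro x hx
    have h := card_symmDiff_add_two_mul_card_inter x y
    rw [disjoint_iff_inter_eq_empty.mp (subset_compl_iff_disjoint_right.mp hx)] at h
    simpa using h
  constructor
  · intro h
    have hle : y.card ≤ m := by
      by_contra! hlt
      obtain ⟨x, hx, hxc⟩ := exists_subset_card_eq (s := yᶜ) (n := min t yᶜ.card)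
        (min_le_right _ _)
      have := h x (by simp only [punctFamily, mem_filter, mem_univ, true_and]; omega)
      rw [hdisj x hx] at this
      omega
    rcases hle.lt_or_eq with hlt | heq
    · exact Or.inl hlt
    · by_cases hay : a ∈ y
      · exact Or.inr (Or.inl ⟨heq, hay⟩)
      · refine Or.inr (Or.inr ⟨heq, hay, fun b hb => ?_⟩)
        by_contra hby
        have hab : a ≠ b := fun e => ha (e ▸ hb)
        obtain ⟨x, hx1, hx2, hxc⟩ := exists_subsuperset_card_eq (s := {a, b}) (t := yᶜ)
          (n := t + 1) (by intro c; simp only [mem_insert, mem_singleton, mem_compl]; grind)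
          (by rw [card_pair hab]; omega) (by omega)
        have hax : a ∈ x := hx1 (by simp)
        have hbx : b ∈ x := hx1 (by simp)
        have := h x (by
          simp only [punctFamily, mem_filter, mem_univ, true_and]
          exact Or.inr ⟨hxc, hax, not_disjoint_iff.mpr ⟨b, hbx, hb⟩⟩)
        rw [hdisj x hx2] at this
        omega
  · intro h x hx
    have hs := card_symmDiff_add_two_mul_card_inter x y
    simp only [punctFamily, mem_filter, mem_univ, true_and] at hx
    rcases hx with hx | ⟨hx, hax, hxK⟩
    · omega
    · rcases h with hy | hy
      · omega
      · have : 0 < (x ∩ y).card := by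
          rw [card_pos]
          rcases hy with hy | hy
          · exact ⟨a, mem_inter.mpr ⟨hax, hy.2⟩⟩
          · obtain ⟨b, hbx, hbK⟩ := not_disjoint_iff.mp hxK
            exact ⟨b, mem_inter.mpr ⟨hbx, hy.2.2 hbK⟩⟩
        omega

theorem card_filter_forall_punctFamily {a : α} {K : Finset α} (ha : a ∉ K) {m t : ℕ}
    (hα : Fintype.card α = 2 * m) (hK : K.card + t = m) (ht : 1 ≤ t) (htm : t + 1 ≤ m) :
    (univ.filter fun y => ∀ x ∈ punctFamily a K t, (symmDiff x y).card ≤ m + t).card =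
      ∑ i ∈ range m, (2 * m).choose i + (2 * m - 1).choose (m - 1) + (m + t - 1).choose t := by
  have h1 := card_filter_card_eq_subset_subset (B := {a}) (D := univ) (by simp)
    (k := m) (by rw [card_singleton]; omega)
  have h2 := card_filter_card_eq_subset_subset (B := K) (D := {a}ᶜ) (by simpa using ha)
    (k := m) (by omega)
  have e1 : 2 * m - 1 - K.card = m + t - 1 := by omega
  have e2 : m - K.card = t := by omega
  rw [Finset.card_univ, card_singleton, hα] at h1
  rw [card_compl, card_singleton, hα, e1, e2] at h2
  rw [← h1, ← h2, ← hα, ← card_filter_card_lt, ← card_union_of_disjoint, ← card_union_of_disjoint]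
  · congr 1
    ext y
    simp only [mem_filter, mem_univ, true_and, mem_union, singleton_subset_iff, subset_univ,
      and_true, subset_compl_iff_disjoint_right,
      disjoint_singleton_right,
      forall_punctFamily_card_symmDiff_le_iff ha hα ht htm]
    tauto
  · rw [disjoint_left]
    intro y
    simp only [mem_filter, mem_univ, true_and, mem_union, singleton_subset_iff, subset_univ,
      and_true, subset_compl_iff_disjoint_right,
      disjoint_singleton_right]
    rintro (h | h) h'
    · omega
    · exact h'.2.2 h.2
  · rw [disjoint_filter]
    rintro x - h ⟨h', -⟩
    omega

end Counting

theorem sum_range_choose_succ_add_choose (N k : ℕ) :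
    ∑ i ∈ range (k + 1), (N + 1).choose i + N.choose k = 2 * ∑ i ∈ range (k + 1), N.choose i := by
  induction k with
  | zero => simp
  | succ k ih =>
    rw [sum_range_succ, sum_range_succ (fun i => N.choose i), Nat.choose_succ_succ']
    omega

theorem sum_range_choose_two_mul_add_choose (k : ℕ) :
    ∑ i ∈ range (k + 1), (2 * (k + 1)).choose i + (2 * k + 1).choose k = 2 ^ (2 * k + 1) := by
  rw [show 2 * (k + 1) = 2 * k + 1 + 1 by ring, sum_range_choose_succ_add_choose,
    Nat.sum_range_choose_halfway, pow_succ, pow_mul]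
  norm_num [mul_comm]

theorem punctFamily_lower {n l t : ℕ} (hl : l < n + 1) {x z : Finset (Fin (n + 1))}
    (hx : x ∈ punctFamily 0 (Icc 1 ⟨l, hl⟩) t) (hz : SimpLT z x) :
    z ∈ punctFamily 0 (Icc 1 ⟨l, hl⟩) t := by
  simp only [punctFamily, mem_filter, mem_univ, true_and] at hx ⊢
  rcases hz with hz | ⟨hc, i, hiz, hix, hmin⟩
  · omega
  rcases hx with hx | ⟨hx, h0, hxK⟩
  · omega
  have h0z : (0 : Fin (n + 1)) ∈ z := by
    by_contra h
    have := hmin 0 (mem_symmDiff.mpr (Or.inr ⟨h0, h⟩))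
    have : i = 0 := Fin.le_zero_iff.mp this
    exact hix (this ▸ h0)
  refine Or.inr ⟨hc.trans hx, h0z, ?_⟩
  obtain ⟨b, hbx, hbK⟩ := not_disjoint_iff.mp hxK
  by_cases hbz : b ∈ z
  · exact not_disjoint_iff.mpr ⟨b, hbz, hbK⟩
  · have hib := hmin b (mem_symmDiff.mpr (Or.inr ⟨hbx, hbz⟩))
    rw [mem_Icc] at hbK
    have hi0 : i ≠ 0 := fun e => hix (e ▸ h0)
    exact not_disjoint_iff.mpr ⟨i, hiz, mem_Icc.mpr
      ⟨Fin.one_le_of_ne_zero hi0, hib.trans hbK.2⟩⟩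

/-- For even `n` and `n/2 + 1 ≤ p ≤ n-2`, with `r' = ∑_{i=0}^{p-n/2} C(n,i) + C(n-1, p-n/2)`
and `s' = C(p-1, p-n/2)`, we have `|C^p(I_{r'-s'})| = 2^{n-1} - (r' - 2s')`. -/
theorem stmt4 (n p : ℕ) (heven : Even n) (hp1 : n / 2 + 1 ≤ p) (hp2 : p ≤ n - 2)
    (r' s' : ℕ)
    (hr : r' = (∑ i ∈ Finset.range (p - n / 2 + 1), Nat.choose n i)
            + Nat.choose (n - 1) (p - n / 2))
    (hs : s' = Nat.choose (p - 1) (p - n / 2)) :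
    ((Cpunct n p (ISeg n (r' - s'))).card : ℤ) = 2 ^ (n - 1) - ((r' : ℤ) - 2 * (s' : ℤ)) := by
  obtain ⟨t, rfl⟩ := Nat.exists_eq_add_of_le (show n / 2 ≤ p by omega)
  obtain ⟨k, rfl⟩ : ∃ k, n = 2 * (k + 1) := by
    obtain ⟨j, rfl⟩ := heven
    exact ⟨j - 1, by omega⟩
  rw [Nat.mul_div_cancel_left _ two_pos] at *
  rw [Nat.add_sub_cancel_left] at hr hs
  have hl : k + 1 - t < 2 * k + 1 + 1 := by omega
  have h1 : ((1 : Fin (2 * k + 1 + 1)) : ℕ) = 1 := by simp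
  set K : Finset (Fin (2 * (k + 1))) := Icc (α := Fin (2 * k + 1 + 1)) 1 ⟨k + 1 - t, hl⟩ with hKdef
  have hK : K.card + t = k + 1 := by
    rw [hKdef, Fin.card_Icc, h1]
    simp only
    omega
  have h0 : (0 : Fin (2 * (k + 1))) ∉ K := by
    rw [hKdef]
    intro h
    have := (mem_Icc.mp h).1
    rw [Fin.le_def, h1] at this
    simp at this
  set A := punctFamily 0 K t with hA
  have hAcard := card_punctFamily_add h0 t
  rw [Fintype.card_fin, show 2 * (k + 1) - K.card - 1 = k + 1 + t - 1 by omega, ← hs, ← hr]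
    at hAcard
  change A.card + s' = r' at hAcard
  have hseg : ISeg (2 * (k + 1)) (r' - s') = A := by
    rw [← hAcard, Nat.add_sub_cancel]
    exact ISeg_card_eq fun x hx z hz => punctFamily_lower hl hx hz
  have hball : (Cball (2 * (k + 1)) (k + 1 + t) A).card = _ :=
    card_filter_forall_punctFamily h0 (Fintype.card_fin _) hK (by omega) (by omega)
  have hsub : A ⊆ Cball (2 * (k + 1)) (k + 1 + t) A := by
    intro y hy
    rw [Cball, mem_filter]
    refine ⟨mem_univ _, (forall_punctFamily_card_symmDiff_le_iff h0 (Fintype.card_fin _)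
      (by omega) (by omega) y).mpr (Or.inl ?_)⟩
    simp only [hA, punctFamily, mem_filter] at hy
    omega
  have hpow := sum_range_choose_two_mul_add_choose k
  rw [show 2 * (k + 1) - 1 = 2 * k + 1 by omega] at hball ⊢
  rw [Nat.add_sub_cancel, hpow, ← hs] at hball
  have hcard := card_sdiff_add_card_eq_card hsub
  rw [← hcard] at hball
  rw [hseg, Cpunct]
  zify at hball hAcard
  linarith
end
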